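/- For every τ in the upper half-plane, G̃_{2,2,4}(τ) = G₈(τ) + (2π²/(3τ²)) G₆(τ) + (4π⁴/(15τ⁴)) G₄(τ) + (32π⁶/(315τ⁶)) G₂(τ) − 184π⁸/(4725τ⁸). -/

import Mathlib

open Real

/-- The Eisenstein series `G_k(τ)` (iterated summation, inner over `n`). -/
noncomputable def G (k : ℕ) (τ : ℂ) : ℂ :=
  ∑' m : ℤ, ∑' n : ℤ, if m = 0 ∧ n = 0 then 0 else 1 / ((m : ℂ) + n * τ) ^ k

/-- The triple Eisenstein-type series `G̃_{2p₁,2p₂,2p₃}(τ)` (iterated order). -/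
noncomputable def tildeG3 (p₁ p₂ p₃ : ℕ) (τ : ℂ) : ℂ :=
  ∑' m : ℤ, ∑' n₁ : ℤ, ∑' n₂ : ℤ, ∑' n₃ : ℤ,
    if (m = 0 ∧ n₁ = 0) ∨ (m = 0 ∧ n₂ = 0) ∨ (m = 0 ∧ n₃ = 0) then 0
    else 1 / (((m : ℂ) + n₁ * τ) ^ (2 * p₁) * ((m : ℂ) + n₂ * τ) ^ (2 * p₂) *
              ((m : ℂ) + n₃ * τ) ^ (2 * p₃))


theorem T_rec (k : ℕ) (q : ℂ) (hq : ‖q‖ < 1) :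
    ∑' n : ℕ, (n : ℂ) ^ (k+1) * q ^ n =
      q * ∑ j ∈ Finset.range (k + 2), ((k+1).choose j : ℂ) * ∑' n : ℕ, (n : ℂ) ^ j * q ^ n := by
  have hs : ∀ j, Summable (fun n : ℕ => (n : ℂ) ^ j * q ^ n) := fun j =>
    summable_pow_mul_geometric_of_norm_lt_one j hq
  rw [(hs (k+1)).tsum_eq_zero_add]
  simp_rw [← tsum_mul_left]
  rw [← Summable.tsum_finsetSum (fun j _ => (hs j).mul_left _), ← tsum_mul_left]
  simp only [Nat.cast_zero, ne_eq, Nat.succ_ne_zero, not_false_eq_true, zero_pow, zero_mul, zero_add]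
  refine tsum_congr fun n => ?_
  push_cast
  rw [add_pow, Finset.mul_sum, Finset.sum_mul]
  refine Finset.sum_congr rfl fun j _ => ?_
  simp; ring

theorem T_closed (q : ℂ) (hq : ‖q‖ < 1) (y : ℂ) (hy : y = q / (1 - q) ^ 2) :
    ∑' n : ℕ, (n : ℂ) ^ 1 * q ^ n = y ∧
    ∑' n : ℕ, (n : ℂ) ^ 3 * q ^ n = y + 6 * y ^ 2 ∧
    ∑' n : ℕ, (n : ℂ) ^ 5 * q ^ n = y + 30 * y ^ 2 + 120 * y ^ 3 ∧
    ∑' n : ℕ, (n : ℂ) ^ 7 * q ^ n = y + 126 * y ^ 2 + 1680 * y ^ 3 + 5040 * y ^ 4 := by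
  have h1 : (1 - q) ≠ 0 := by
    intro h
    have : q = 1 := by linear_combination -h
    simp [this] at hq
  obtain ⟨T, hT⟩ : ∃ T : ℕ → ℂ, ∀ k, T k = ∑' n : ℕ, (n : ℂ) ^ k * q ^ n := ⟨_, fun _ => rfl⟩
  have hr : ∀ k, T (k+1) = q * ∑ j ∈ Finset.range (k + 2), ((k+1).choose j : ℂ) * T j := by
    intro k; simp_rw [hT]; exact T_rec k q hq
  simp_rw [← hT]
  have t0 : T 0 = 1 / (1 - q) := by
    rw [hT]; simp [tsum_geometric_of_norm_lt_one hq]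
  have t1 : T 1 = q / (1 - q)^2 := by
    have := hr 0
    simp [Finset.sum_range_succ, t0] at this
    field_simp at this ⊢
    linear_combination this
  have t2 : T 2 = (q + q^2) / (1 - q)^3 := by
    have := hr 1
    simp [Finset.sum_range_succ, t0, t1, Nat.choose] at this
    field_simp at this ⊢
    linear_combination this
  have t3 : T 3 = (q + 4 * q^2 + q^3) / (1 - q)^4 := by
    have := hr 2
    simp [Finset.sum_range_succ, t0, t1, t2, Nat.choose] at this
    field_simp at this ⊢
    linear_combination this
  have t4 : T 4 = (q + 11 * q^2 + 11 * q^3 + q^4) / (1 - q)^5 := by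
    have := hr 3
    simp [Finset.sum_range_succ, t0, t1, t2, t3, Nat.choose] at this
    field_simp at this ⊢
    linear_combination this
  have t5 : T 5 = (q + 26 * q^2 + 66 * q^3 + 26 * q^4 + q^5) / (1 - q)^6 := by
    have := hr 4
    simp [Finset.sum_range_succ, t0, t1, t2, t3, t4, Nat.choose] at this
    field_simp at this ⊢
    linear_combination this
  have t6 : T 6 = (q + 57 * q^2 + 302 * q^3 + 302 * q^4 + 57 * q^5 + q^6) / (1 - q)^7 := by
    have := hr 5
    simp [Finset.sum_range_succ, t0, t1, t2, t3, t4, t5, Nat.choose] at this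
    field_simp at this ⊢
    linear_combination this
  have t7 : T 7 = (q + 120 * q^2 + 1191 * q^3 + 2416 * q^4 + 1191 * q^5 + 120 * q^6 + q^7) / (1 - q)^8 := by
    have := hr 6
    simp [Finset.sum_range_succ, t0, t1, t2, t3, t4, t5, t6, Nat.choose] at this
    field_simp at this ⊢
    linear_combination this
  refine ⟨?_, ?_, ?_, ?_⟩
  · rw [t1, hy]
  · rw [t3, hy]; field_simp; ring
  · rw [t5, hy]; field_simp; ring
  · rw [t7, hy]; field_simp; ring

theorem b6 : bernoulli 6 = 1/42 := by
  rw [bernoulli_eq_bernoulli'_of_ne_one (by norm_num), bernoulli'_def]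
  norm_num [Finset.sum_range_succ, Nat.choose, bernoulli'_four, bernoulli'_eq_zero_of_odd]
theorem b8 : bernoulli 8 = -1/30 := by
  have := b6
  rw [bernoulli_eq_bernoulli'_of_ne_one (by norm_num)] at this
  rw [bernoulli_eq_bernoulli'_of_ne_one (by norm_num), bernoulli'_def]
  norm_num [Finset.sum_range_succ, Nat.choose, bernoulli'_four, this,
    bernoulli'_eq_zero_of_odd (n := 5) (by decide) (by norm_num),
    bernoulli'_eq_zero_of_odd (n := 7) (by decide) (by norm_num)]

/-- Inner sum. -/
noncomputable def Frow (k : ℕ) (τ : ℂ) (m : ℤ) : ℂ :=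
  ∑' n : ℤ, if m = 0 ∧ n = 0 then 0 else 1 / ((m : ℂ) + n * τ) ^ k

theorem tilde_eq (τ : ℂ) : tildeG3 1 1 2 τ = ∑' m : ℤ, Frow 2 τ m * Frow 2 τ m * Frow 4 τ m := by
  unfold tildeG3 Frow
  refine tsum_congr fun m => ?_
  rw [mul_assoc, ← tsum_mul_right]
  refine tsum_congr fun n₁ => ?_
  rw [← tsum_mul_right, ← tsum_mul_left]
  refine tsum_congr fun n₂ => ?_
  rw [← mul_assoc, ← tsum_mul_left]
  refine tsum_congr fun n₃ => ?_
  by_cases h1 : m = 0 ∧ n₁ = 0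
  · simp [h1]
  by_cases h2 : m = 0 ∧ n₂ = 0
  · simp [h2]
  by_cases h3 : m = 0 ∧ n₃ = 0
  · simp [h3]
  rw [if_neg h1, if_neg h2, if_neg h3, if_neg (by tauto)]
  simp only [one_div, mul_inv, mul_one, Nat.reduceMul]

theorem Frow_neg (k : ℕ) (hk : Even k) (τ : ℂ) (m : ℤ) : Frow k τ (-m) = Frow k τ m := by
  unfold Frow
  rw [← (Equiv.neg ℤ).tsum_eq]
  refine tsum_congr fun n => ?_
  simp only [Equiv.neg_apply, neg_eq_zero]
  congr 2
  push_cast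
  rw [← hk.neg_pow]
  congr 1; ring

theorem Frow_zero (k : ℕ) (hk : Even k) (h2 : 2 ≤ k) (τ : ℂ) :
    Frow k τ 0 = 2 * riemannZeta k / τ ^ k := by
  rw [two_mul_riemannZeta_eq_tsum_int_inv_pow_of_even h2 hk, Frow, ← tsum_div_const]
  refine tsum_congr fun n => ?_
  by_cases h : n = 0
  · subst h
    simp [show k ≠ 0 by omega]
  · simp [h, mul_pow, div_eq_mul_inv]
    ring

theorem im_pos_aux (τ : ℂ) (hτ : 0 < τ.im) (n : ℕ) : 0 < (-((n : ℂ) + 1) / τ).im := by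
  have h3 : -((n : ℂ) + 1) / τ = ((-((n : ℝ) + 1) : ℝ) : ℂ) * τ⁻¹ := by
    push_cast; rw [div_eq_mul_inv]
  have hτ0 : τ ≠ 0 := by rintro rfl; simp at hτ
  rw [h3, Complex.im_ofReal_mul, Complex.inv_im]
  have h4 : 0 < Complex.normSq τ := Complex.normSq_pos.mpr hτ0
  have : -((n : ℝ) + 1) * (-τ.im / Complex.normSq τ) = ((n : ℝ) + 1) * (τ.im / Complex.normSq τ) := by
    ring
  rw [this]
  positivity

theorem Frow_neg_succ (k : ℕ) (hk : 1 ≤ k) (τ : ℂ) (hτ : 0 < τ.im) (n : ℕ) :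
    Frow (k + 1) τ (-((n : ℤ) + 1)) = ((-2 * π * Complex.I) ^ (k + 1) / k.factorial) *
      (∑' j : ℕ, (j : ℂ) ^ k * (Complex.exp (-(2 * π * Complex.I / τ)) ^ (n + 1)) ^ j)
        / τ ^ (k + 1) := by
  have hτ0 : τ ≠ 0 := by rintro rfl; simp at hτ
  have h := EisensteinSeries.qExpansion_identity hk ⟨_, im_pos_aux τ hτ n⟩
  have he : Complex.exp (2 * π * Complex.I * (-((n : ℂ) + 1) / τ)) =
      Complex.exp (-(2 * π * Complex.I / τ)) ^ (n + 1) := by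
    rw [← Complex.exp_nat_mul]
    congr 1
    push_cast
    field_simp
  simp only [he] at h
  rw [← h, Frow, ← tsum_div_const]
  refine tsum_congr fun j => ?_
  rw [if_neg (by omega), div_div, ← mul_pow]
  congr 2
  push_cast
  field_simp

theorem main_r (τ : ℂ) (hτ : 0 < τ.im) : ‖Complex.exp (-(2 * π * Complex.I / τ))‖ < 1 := by
  have h := im_pos_aux τ hτ 0
  have : -(2 * π * Complex.I / τ) = ((2 * π : ℝ) : ℂ) * (Complex.I * (-(((0 : ℕ) : ℂ) + 1) / τ)) := by
    push_cast; ring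
  rw [this, Complex.norm_exp, Complex.re_ofReal_mul, Complex.I_mul_re, Real.exp_lt_one_iff]
  have := Real.pi_pos
  nlinarith [mul_pos this h]

/-- The basic exponentially decaying quantity. -/
noncomputable def Y (r : ℂ) (n : ℕ) : ℂ := r ^ (n + 1) / (1 - r ^ (n + 1)) ^ 2

theorem norm_pow_lt (r : ℂ) (hr : ‖r‖ < 1) (n : ℕ) : ‖r ^ (n + 1)‖ < 1 := by
  rw [norm_pow]; exact pow_lt_one₀ (norm_nonneg _) hr (by omega)

theorem summable_Y (r : ℂ) (hr : ‖r‖ < 1) (j : ℕ) : Summable (fun n => Y r n ^ (j + 1)) := by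
  have hg : Summable (fun n : ℕ => ‖r‖ ^ n * (1 / (1 - ‖r‖) ^ 2) ^ (j + 1)) :=
    (summable_geometric_of_lt_one (norm_nonneg _) hr).mul_right _
  refine Summable.of_norm_bounded hg fun n => ?_
  have h1 : 0 < 1 - ‖r‖ := by linarith
  have h2 : ‖r‖ ^ (n + 1) ≤ ‖r‖ := pow_le_of_le_one (norm_nonneg _) hr.le (by omega)
  have h3 : 1 - ‖r‖ ≤ ‖1 - r ^ (n + 1)‖ := by
    have := norm_sub_norm_le (1 : ℂ) (r ^ (n + 1))
    rw [norm_one, norm_pow] at this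
    linarith
  rw [Y, norm_pow, norm_div, norm_pow (1 - r ^ (n + 1)), div_eq_mul_one_div, mul_pow]
  gcongr
  calc ‖r ^ (n + 1)‖ ^ (j + 1) ≤ ‖r ^ (n + 1)‖ :=
        pow_le_of_le_one (norm_nonneg _) (norm_pow_lt r hr n).le (by omega)
    _ = ‖r‖ ^ (n + 1) := norm_pow _ _
    _ ≤ ‖r‖ ^ n := pow_le_pow_of_le_one (norm_nonneg _) hr.le (by omega)

theorem Frow_closed (τ : ℂ) (hτ : 0 < τ.im) (n : ℕ) (y : ℂ)
    (hy : y = Y (Complex.exp (-(2 * π * Complex.I / τ))) n) :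
    Frow 2 τ (-((n : ℤ) + 1)) = (-4 * π ^ 2) * y / τ ^ 2 ∧
    Frow 4 τ (-((n : ℤ) + 1)) = (16 * π ^ 4 / 6) * (y + 6 * y ^ 2) / τ ^ 4 ∧
    Frow 6 τ (-((n : ℤ) + 1)) = (-64 * π ^ 6 / 120) * (y + 30 * y ^ 2 + 120 * y ^ 3) / τ ^ 6 ∧
    Frow 8 τ (-((n : ℤ) + 1)) =
      (256 * π ^ 8 / 5040) * (y + 126 * y ^ 2 + 1680 * y ^ 3 + 5040 * y ^ 4) / τ ^ 8 := by
  have hT := T_closed _ (norm_pow_lt _ (main_r τ hτ) n) y (by rw [hy, Y])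
  obtain ⟨h1, h3, h5, h7⟩ := hT
  have I2 : Complex.I ^ 2 = -1 := Complex.I_sq
  have I4 : Complex.I ^ 4 = 1 := Complex.I_pow_four
  have I6 : Complex.I ^ 6 = -1 := by
    rw [show 6 = 4 + 2 from rfl, pow_add, I4, I2]; norm_num
  have I8 : Complex.I ^ 8 = 1 := by
    rw [show 8 = 4 + 4 from rfl, pow_add, I4]; norm_num
  refine ⟨?_, ?_, ?_, ?_⟩
  · rw [Frow_neg_succ 1 (by norm_num) τ hτ n, h1]
    norm_num [mul_pow, I2, Nat.factorial]
  · rw [Frow_neg_succ 3 (by norm_num) τ hτ n, h3]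
    norm_num [mul_pow, I4, Nat.factorial]
  · rw [Frow_neg_succ 5 (by norm_num) τ hτ n, h5]
    norm_num [mul_pow, I6, Nat.factorial]
  · rw [Frow_neg_succ 7 (by norm_num) τ hτ n, h7]
    norm_num [mul_pow, I8, Nat.factorial]

theorem summable_Frow_of (k : ℕ) (hk : Even k) (τ : ℂ)
    (h : Summable (fun n : ℕ => Frow k τ (-((n : ℤ) + 1)))) : Summable (Frow k τ) := by
  refine Summable.of_add_one_of_neg_add_one ?_ h
  refine h.congr fun n => ?_
  rw [Frow_neg k hk]

theorem summable_Frow (τ : ℂ) (hτ : 0 < τ.im) :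
    Summable (Frow 2 τ) ∧ Summable (Frow 4 τ) ∧ Summable (Frow 6 τ) ∧ Summable (Frow 8 τ) := by
  have hc := fun n => Frow_closed τ hτ n _ rfl
  have hr := main_r τ hτ
  have s1 := summable_Y _ hr 0
  have s2 := summable_Y _ hr 1
  have s3 := summable_Y _ hr 2
  have s4 := summable_Y _ hr 3
  simp only [zero_add, pow_one, Nat.reduceAdd] at s1 s2 s3 s4
  refine ⟨summable_Frow_of _ (by decide) τ ?_, summable_Frow_of _ (by decide) τ ?_,
    summable_Frow_of _ (by decide) τ ?_, summable_Frow_of _ (by decide) τ ?_⟩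
  · simp_rw [fun n => (hc n).1]
    exact (s1.mul_left _).div_const _
  · simp_rw [fun n => (hc n).2.1]
    exact ((s1.add (s2.mul_left _)).mul_left _).div_const _
  · simp_rw [fun n => (hc n).2.2.1]
    exact (((s1.add (s2.mul_left _)).add (s3.mul_left _)).mul_left _).div_const _
  · simp_rw [fun n => (hc n).2.2.2]
    exact ((((s1.add (s2.mul_left _)).add (s3.mul_left _)).add (s4.mul_left _)).mul_left _).div_const _

theorem zeta_six : riemannZeta (6 : ℕ) = (π : ℂ) ^ 6 / 945 := by
  have h := riemannZeta_two_mul_nat (k := 3) (by norm_num)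
  norm_num [b6, Nat.factorial] at h
  norm_num
  rw [h]; ring

theorem zeta_eight : riemannZeta (8 : ℕ) = (π : ℂ) ^ 8 / 9450 := by
  have h := riemannZeta_two_mul_nat (k := 4) (by norm_num)
  norm_num [b8, Nat.factorial] at h
  norm_num
  rw [h]; ring

theorem row_identity (τ : ℂ) (hτ : 0 < τ.im) (m : ℤ) :
    Frow 2 τ m * Frow 2 τ m * Frow 4 τ m = Frow 8 τ m + 2 * (π : ℂ) ^ 2 / (3 * τ ^ 2) * Frow 6 τ m
      + 4 * (π : ℂ) ^ 4 / (15 * τ ^ 4) * Frow 4 τ m + 32 * (π : ℂ) ^ 6 / (315 * τ ^ 6) * Frow 2 τ m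
      - if m = 0 then 184 * (π : ℂ) ^ 8 / (4725 * τ ^ 8) else 0 := by
  have hτ0 : τ ≠ 0 := by rintro rfl; simp at hτ
  have key : ∀ n : ℕ, ∀ m : ℤ, m = -((n : ℤ) + 1) →
      Frow 2 τ m * Frow 2 τ m * Frow 4 τ m = Frow 8 τ m + 2 * (π : ℂ) ^ 2 / (3 * τ ^ 2) * Frow 6 τ m
      + 4 * (π : ℂ) ^ 4 / (15 * τ ^ 4) * Frow 4 τ m
      + 32 * (π : ℂ) ^ 6 / (315 * τ ^ 6) * Frow 2 τ m := by
    rintro n m rfl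
    obtain ⟨h2, h4, h6, h8⟩ := Frow_closed τ hτ n _ rfl
    rw [h2, h4, h6, h8]
    generalize Y _ n = y
    field_simp
    ring
  rcases lt_trichotomy m 0 with h | h | h
  · rw [if_neg h.ne, sub_zero]
    exact key (-m - 1).toNat m (by omega)
  · subst h
    rw [Frow_zero 2 (by decide) (by norm_num), Frow_zero 4 (by decide) (by norm_num),
      Frow_zero 6 (by decide) (by norm_num), Frow_zero 8 (by decide) (by norm_num),
      zeta_six, zeta_eight]
    push_cast
    rw [riemannZeta_two, riemannZeta_four]
    field_simp
    ring
  · rw [if_neg h.ne', sub_zero]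
    have := key (m - 1).toNat (-m) (by omega)
    rwa [Frow_neg 2 (by decide), Frow_neg 4 (by decide), Frow_neg 6 (by decide),
      Frow_neg 8 (by decide)] at this

theorem tildeG_two_two_four (τ : ℂ) (hτ : 0 < τ.im) :
    tildeG3 1 1 2 τ = G 8 τ + 2 * (π : ℂ) ^ 2 / (3 * τ ^ 2) * G 6 τ + 4 * (π : ℂ) ^ 4 / (15 * τ ^ 4) * G 4 τ +
      32 * (π : ℂ) ^ 6 / (315 * τ ^ 6) * G 2 τ - 184 * (π : ℂ) ^ 8 / (4725 * τ ^ 8) := by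
  obtain ⟨s2, s4, s6, s8⟩ := summable_Frow τ hτ
  have hG : ∀ k, G k τ = ∑' m : ℤ, Frow k τ m := fun k => rfl
  rw [tilde_eq, hG, hG, hG, hG, tsum_congr (row_identity τ hτ)]
  have t6 := s6.mul_left (2 * (π : ℂ) ^ 2 / (3 * τ ^ 2))
  have t4 := s4.mul_left (4 * (π : ℂ) ^ 4 / (15 * τ ^ 4))
  have t2 := s2.mul_left (32 * (π : ℂ) ^ 6 / (315 * τ ^ 6))
  have t0 : Summable (fun m : ℤ => if m = 0 then 184 * (π : ℂ) ^ 8 / (4725 * τ ^ 8) else 0) :=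
    (hasSum_ite_eq 0 _).summable
  rw [Summable.tsum_sub (((s8.add t6).add t4).add t2) t0, Summable.tsum_add ((s8.add t6).add t4) t2,
    Summable.tsum_add (s8.add t6) t4, Summable.tsum_add s8 t6, tsum_mul_left, tsum_mul_left,
    tsum_mul_left, tsum_ite_eq]
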